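/- There is a constant C > 0 depending only on n such that for every λ ≥ 1 and every torus eigenfunction φ with frequency λ normalized by ∫_{[0,1)ⁿ} φ² dx = 1, one has λ · (∫_{[0,1)ⁿ} |φ| dx)² ≤ C · H^{n−1}(Z_φ). -/

import Mathlib

open MeasureTheory
open scoped ENNReal

/-- The Euclidean Laplacian, as the sum of second partial derivatives. -/
noncomputable def lap {n : ℕ} (φ : EuclideanSpace ℝ (Fin n) → ℝ)
    (x : EuclideanSpace ℝ (Fin n)) : ℝ :=
  ∑ i, fderiv ℝ (fun y => fderiv ℝ φ y (EuclideanSpace.single i 1)) x (EuclideanSpace.single i 1)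

/-- A function on ℝⁿ is ℤⁿ-periodic if it is invariant under translation by
every integer vector. -/
def ZnPeriodic {n : ℕ} (φ : EuclideanSpace ℝ (Fin n) → ℝ) : Prop :=
  ∀ (x : EuclideanSpace ℝ (Fin n)) (k : Fin n → ℤ),
    φ (x + (WithLp.equiv 2 (Fin n → ℝ)).symm fun i => (k i : ℝ)) = φ x

/-- The fundamental domain [0,1)ⁿ of the torus ℝⁿ/ℤⁿ. -/
def fund (n : ℕ) : Set (EuclideanSpace ℝ (Fin n)) := {x | ∀ i, x i ∈ Set.Ico (0:ℝ) 1}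

/-- φ is a torus eigenfunction with frequency λ: smooth, ℤⁿ-periodic, not
identically zero, with Δφ = -λ²φ. -/
def IsTorusEigenfunction {n : ℕ} (lam : ℝ) (φ : EuclideanSpace ℝ (Fin n) → ℝ) : Prop :=
  ContDiff ℝ (⊤ : ℕ∞) φ ∧ ZnPeriodic φ ∧ φ ≠ 0 ∧ ∀ x, lap φ x = -lam ^ 2 * φ x

open Set Filter Topology

lemma fund_eq_fundamentalDomain (n : ℕ) :
    fund n = ZSpan.fundamentalDomain (EuclideanSpace.basisFun (Fin n) ℝ).toBasis := by
  ext x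
  simp [fund, ZSpan.mem_fundamentalDomain]

lemma measurableSet_fund (n : ℕ) : MeasurableSet (fund n) := by
  rw [fund_eq_fundamentalDomain]
  exact ZSpan.fundamentalDomain_measurableSet _

lemma isBounded_fund (n : ℕ) : Bornology.IsBounded (fund n) := by
  rw [fund_eq_fundamentalDomain]
  exact ZSpan.fundamentalDomain_isBounded _

lemma volume_fund_lt_top (n : ℕ) : volume (fund n) < ∞ :=
  (isBounded_fund n).measure_lt_top

lemma ZnPeriodic.setIntegral_fund_add {n : ℕ} {G : EuclideanSpace ℝ (Fin n) → ℝ}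
    (hG : ZnPeriodic G) (v : EuclideanSpace ℝ (Fin n)) :
    ∫ x in fund n, G (x + v) = ∫ x in fund n, G x := by
  have hF := ZSpan.isAddFundamentalDomain' (EuclideanSpace.basisFun (Fin n) ℝ).toBasis
    (volume : Measure (EuclideanSpace ℝ (Fin n)))
  rw [← fund_eq_fundamentalDomain] at hF
  have hmp : MeasurePreserving (fun x : EuclideanSpace ℝ (Fin n) => x + v) volume volume :=
    measurePreserving_add_right volume v
  have hmp' : MeasurePreserving (fun x : EuclideanSpace ℝ (Fin n) => x - v) volume volume := by
    simpa [sub_eq_add_neg] using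
      measurePreserving_add_right (volume : Measure (EuclideanSpace ℝ (Fin n))) (-v)
  have hF' := hF.preimage_of_equiv hmp'.quasiMeasurePreserving (e := id) Function.bijective_id
    (fun g x => add_sub_assoc (g : EuclideanSpace ℝ (Fin n)) x v)
  have : Countable (Submodule.span ℤ
      (range (EuclideanSpace.basisFun (Fin n) ℝ).toBasis)).toAddSubgroup :=
    inferInstanceAs (Countable (Submodule.span ℤ
      (range (EuclideanSpace.basisFun (Fin n) ℝ).toBasis)))
  have key := hF.setIntegral_eq hF' (f := G) (by
    intro g x
    have hg := (Module.Basis.mem_span_iff_repr_mem ℤ _ _).1 g.2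
    choose k hk using hg
    have : (g : EuclideanSpace ℝ (Fin n))
        = (WithLp.equiv 2 (Fin n → ℝ)).symm fun i => (k i : ℝ) := by
      ext i
      simpa using (hk i).symm
    rw [AddSubgroup.vadd_def, vadd_eq_add, add_comm, this, hG x k])
  rw [key, ← hmp.setIntegral_preimage_emb (measurableEmbedding_addRight v) G]
  simp [← preimage_comp, Function.comp_def]

lemma ZnPeriodic.add_single {n : ℕ} {G : EuclideanSpace ℝ (Fin n) → ℝ} (hG : ZnPeriodic G)
    (i : Fin n) (x : EuclideanSpace ℝ (Fin n)) : G (x + EuclideanSpace.single i 1) = G x := by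
  rw [← hG x (Pi.single i 1)]
  congr 2
  ext j
  by_cases h : j = i
  · subst h; simp
  · simp [h]

/-- The volume of the set swept by a set `Z` translated along a coordinate segment of length `t`
is at most a dimensional constant times `t` times its `(n-1)`-dimensional Hausdorff measure. -/
lemma volume_sweep_le {n : ℕ} (hn : 2 ≤ n) (i : Fin n) {t : ℝ} (ht : 0 < t)
    (Z : Set (EuclideanSpace ℝ (Fin n))) :
    volume {x : EuclideanSpace ℝ (Fin n) |
        ∃ τ ∈ Icc 0 t, x - τ • EuclideanSpace.single i (1 : ℝ) ∈ Z} ≤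
      ENNReal.ofReal (3 * 2 ^ (n - 1) * t) * μH[(n : ℝ) - 1] Z := by
  set S : Set (EuclideanSpace ℝ (Fin n)) → Set (EuclideanSpace ℝ (Fin n)) := fun U =>
    {x | ∃ τ ∈ Icc 0 t, x - τ • EuclideanSpace.single i (1 : ℝ) ∈ U} with hS
  have hsmall : ∀ U : Set (EuclideanSpace ℝ (Fin n)), Metric.ediam U ≤ ENNReal.ofReal t →
      volume (S U) ≤ ENNReal.ofReal (3 * 2 ^ (n - 1) * t) *
        ⨆ _ : U.Nonempty, Metric.ediam U ^ ((n : ℝ) - 1) := by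
    intro U hU
    rcases U.eq_empty_or_nonempty with rfl | ⟨p, hp⟩
    · simp [hS]
    have hne : U.Nonempty := ⟨p, hp⟩
    have hfin : Metric.ediam U ≠ ∞ := ne_top_of_le_ne_top ENNReal.ofReal_ne_top hU
    set d := Metric.diam U with hd
    have hd0 : 0 ≤ d := Metric.diam_nonneg
    have hed : Metric.ediam U = ENNReal.ofReal d := (ENNReal.ofReal_toReal hfin).symm
    have hdt : d ≤ t := by
      rw [hed] at hU
      exact (ENNReal.ofReal_le_ofReal_iff ht.le).1 hU
    have hbdd : Bornology.IsBounded U := Metric.isBounded_iff_ediam_ne_top.2 hfin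
    have hsub : S U ⊆ (WithLp.ofLp (p := 2)) ⁻¹' (Set.pi univ fun j =>
        Icc (p j - d) (p j + d + if j = i then t else 0)) := by
      rintro x ⟨τ, ⟨hτ0, hτ1⟩, hx⟩ j -
      have hc : |x j - τ * (if j = i then 1 else 0) - p j| ≤ d := by
        have h1 := Metric.dist_le_diam_of_mem hbdd hx hp
        rw [dist_eq_norm] at h1
        have h2 := (PiLp.norm_apply_le (x - τ • EuclideanSpace.single i (1 : ℝ) - p) j).trans h1
        simpa [Pi.single_apply, Real.norm_eq_abs] using h2
      have := abs_le.1 hc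
      simp only [mem_Icc]
      by_cases h : j = i
      · simp only [h, if_true, mul_one] at this ⊢
        constructor <;> linarith [this.1, this.2]
      · simp only [h, if_false, mul_zero] at this ⊢
        constructor <;> linarith [this.1, this.2]
    calc volume (S U) ≤ _ := measure_mono hsub
      _ = volume (Set.pi univ fun j =>
            Icc (p j - d) (p j + d + if j = i then t else 0)) :=
          (PiLp.volume_preserving_ofLp (Fin n)).measure_preimage
            (MeasurableSet.univ_pi fun j => measurableSet_Icc).nullMeasurableSet
      _ = ∏ j, ENNReal.ofReal (2 * d + if j = i then t else 0) := by
          rw [volume_pi_pi]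
          refine Finset.prod_congr rfl fun j _ => ?_
          rw [Real.volume_Icc]
          congr 1
          ring
      _ = ENNReal.ofReal ((2 * d + t) * (2 * d) ^ (n - 1)) := by
          rw [← ENNReal.ofReal_prod_of_nonneg (fun j _ => by split_ifs <;> positivity),
            ← Finset.mul_prod_erase _ _ (Finset.mem_univ i)]
          congr 1
          rw [if_pos rfl]
          congr 1
          rw [Finset.prod_congr rfl (g := fun _ => 2 * d) (fun j hj => by
            simp [Finset.ne_of_mem_erase hj])]
          simp
      _ ≤ ENNReal.ofReal (3 * 2 ^ (n - 1) * t * d ^ (n - 1)) := by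
          apply ENNReal.ofReal_le_ofReal
          rw [mul_pow]
          have : 0 ≤ 2 ^ (n - 1) * d ^ (n - 1) := by positivity
          nlinarith
      _ = _ := by
          rw [ENNReal.ofReal_mul (by positivity), iSup_pos hne, hed,
            show ((n : ℝ) - 1) = ((n - 1 : ℕ) : ℝ) by push_cast [show 1 ≤ n by omega]; ring,
            ENNReal.rpow_natCast, ENNReal.ofReal_pow hd0]
  have hC0 : ENNReal.ofReal (3 * 2 ^ (n - 1) * t) ≠ 0 := by
    simpa using (by positivity : 0 < 3 * 2 ^ (n - 1) * t)
  rw [Measure.hausdorffMeasure_apply]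
  refine le_trans ?_ (mul_le_mul_right (le_iSup₂ (ENNReal.ofReal t) (by simpa using ht)) _)
  rw [← ENNReal.div_le_iff' hC0 ENNReal.ofReal_ne_top]
  refine le_iInf₂ fun U hU => le_iInf fun hUd => ?_
  rw [ENNReal.div_le_iff' hC0 ENNReal.ofReal_ne_top,
    ← ENNReal.tsum_mul_left]
  calc volume (S Z) ≤ volume (⋃ k, S (U k)) := by
        refine measure_mono ?_
        rintro x ⟨τ, hτ, hx⟩
        obtain ⟨k, hk⟩ := mem_iUnion.1 (hU hx)
        exact mem_iUnion.2 ⟨k, τ, hτ, hk⟩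
    _ ≤ ∑' k, volume (S (U k)) := measure_iUnion_le _
    _ ≤ _ := ENNReal.tsum_le_tsum fun k => hsmall _ (hUd k)

/-- The `i`-th partial derivative. -/
noncomputable def partialDeriv {n : ℕ} (i : Fin n) (u : EuclideanSpace ℝ (Fin n) → ℝ)
    (x : EuclideanSpace ℝ (Fin n)) : ℝ :=
  fderiv ℝ u x (EuclideanSpace.single i 1)

section PartialDeriv

variable {n : ℕ} {u v : EuclideanSpace ℝ (Fin n) → ℝ}

lemma ContDiff.partialDeriv (hu : ContDiff ℝ (⊤ : ℕ∞) u) (i : Fin n) :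
    ContDiff ℝ (⊤ : ℕ∞) (partialDeriv i u) :=
  (hu.fderiv_right (m := (⊤ : ℕ∞)) (by simp)).clm_apply contDiff_const

lemma ZnPeriodic.partialDeriv (hu : ZnPeriodic u) (i : Fin n) :
    ZnPeriodic (partialDeriv i u) := by
  intro x k
  unfold _root_.partialDeriv
  rw [← fderiv_comp_add_right]
  congr 2
  ext y
  exact hu y k

lemma partialDeriv_comm (hu : ContDiff ℝ (⊤ : ℕ∞) u) (i j : Fin n) :
    partialDeriv i (partialDeriv j u) = partialDeriv j (partialDeriv i u) := by
  ext x
  have hd : DifferentiableAt ℝ (fderiv ℝ u) x :=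
    ((hu.fderiv_right (m := (⊤ : ℕ∞)) (by simp)).differentiable (by simp)).differentiableAt
  have h : ∀ i j : Fin n, _root_.partialDeriv i (_root_.partialDeriv j u) x =
      fderiv ℝ (fderiv ℝ u) x (EuclideanSpace.single i 1) (EuclideanSpace.single j 1) := by
    intro i j
    unfold _root_.partialDeriv
    rw [fderiv_clm_apply hd (differentiableAt_const _)]
    simp
  rw [h, h]
  exact hu.contDiffAt.isSymmSndFDerivAt (by simp; exact WithTop.coe_le_coe.2 le_top) _ _

lemma partialDeriv_mul (hu : ContDiff ℝ (⊤ : ℕ∞) u) (hv : ContDiff ℝ (⊤ : ℕ∞) v) (i : Fin n)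
    (x : EuclideanSpace ℝ (Fin n)) :
    partialDeriv i (fun y => u y * v y) x = u x * partialDeriv i v x + partialDeriv i u x * v x := by
  unfold partialDeriv
  rw [fderiv_fun_mul (hu.differentiable (by simp) x) (hv.differentiable (by simp) x)]
  simp [mul_comm]

lemma partialDeriv_comp {g : ℝ → ℝ} {g' : ℝ} {x : EuclideanSpace ℝ (Fin n)}
    (hg : HasDerivAt g g' (u x)) (hu : ContDiff ℝ (⊤ : ℕ∞) u) (i : Fin n) :
    partialDeriv i (fun y => g (u y)) x = g' * partialDeriv i u x := by
  unfold partialDeriv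
  have h := hg.comp_hasFDerivAt x (hu.differentiable (by simp) x).hasFDerivAt
  rw [show (fun y => g (u y)) = g ∘ u from rfl, h.fderiv]
  simp

lemma partialDeriv_sum {ι : Type*} (s : Finset ι) {w : ι → EuclideanSpace ℝ (Fin n) → ℝ}
    (hw : ∀ k, ContDiff ℝ (⊤ : ℕ∞) (w k)) (i : Fin n) (x : EuclideanSpace ℝ (Fin n)) :
    partialDeriv i (fun y => ∑ k ∈ s, w k y) x = ∑ k ∈ s, partialDeriv i (w k) x := by
  unfold partialDeriv
  rw [fderiv_fun_sum fun k _ => (hw k).differentiable (by simp) x]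
  simp

lemma Continuous.integrableOn_fund (hu : Continuous u) : IntegrableOn u (fund n) :=
  (hu.continuousOn.integrableOn_compact (isBounded_fund n).isCompact_closure).mono_set
    subset_closure

lemma tendsto_integral_difference_quotient (hu : ContDiff ℝ (⊤ : ℕ∞) u) (i : Fin n)
    {w : EuclideanSpace ℝ (Fin n) → ℝ} (hw : Measurable w) (hw1 : ∀ x, |w x| ≤ 1) :
    Tendsto (fun t : ℝ => ∫ x in fund n,
        w x * (t⁻¹ * (u (x + t • EuclideanSpace.single i (1 : ℝ)) - u x)))
      (𝓝[>] 0) (𝓝 (∫ x in fund n, w x * partialDeriv i u x)) := by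
  have hfin := volume_fund_lt_top n
  have : IsFiniteMeasure ((volume : Measure (EuclideanSpace ℝ (Fin n))).restrict (fund n)) :=
    ⟨by simpa using hfin⟩
  obtain ⟨R, hR⟩ := (isBounded_fund n).subset_closedBall 0
  obtain ⟨M, hM⟩ := (isCompact_closedBall (0 : EuclideanSpace ℝ (Fin n))
    (R + 1)).exists_bound_of_continuousOn (hu.continuous_fderiv (by simp)).continuousOn
  refine tendsto_integral_filter_of_dominated_convergence (fun _ => M) ?_ ?_
    (integrable_const _) ?_
  · refine Eventually.of_forall fun t => ?_
    have := hu.continuous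
    exact (hw.mul (Continuous.measurable (by fun_prop))).aestronglyMeasurable
  · filter_upwards [Ioc_mem_nhdsGT (zero_lt_one' ℝ)] with t ht
    refine (ae_restrict_iff' (measurableSet_fund n)).2 (Eventually.of_forall fun x hx => ?_)
    have hx1 : x ∈ Metric.closedBall (0 : EuclideanSpace ℝ (Fin n)) (R + 1) :=
      Metric.closedBall_subset_closedBall (by linarith) (hR hx)
    have hx2 : x + t • EuclideanSpace.single i (1 : ℝ) ∈
        Metric.closedBall (0 : EuclideanSpace ℝ (Fin n)) (R + 1) := by
      have h0 := hR hx
      rw [mem_closedBall_zero_iff] at h0 ⊢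
      refine (norm_add_le _ _).trans (add_le_add h0 ?_)
      simpa [norm_smul, abs_of_pos ht.1] using ht.2
    have h := (convex_closedBall _ _).norm_image_sub_le_of_norm_fderiv_le
      (fun y _ => hu.differentiable (by simp) y) hM hx1 hx2
    simp only [add_sub_cancel_left, norm_smul, PiLp.norm_single, norm_one, mul_one,
      Real.norm_eq_abs, abs_of_pos ht.1] at h
    rw [Real.norm_eq_abs, abs_mul, abs_mul, abs_inv, abs_of_pos ht.1]
    calc |w x| * (t⁻¹ * |u (x + t • EuclideanSpace.single i (1 : ℝ)) - u x|)
        ≤ 1 * (t⁻¹ * (M * t)) := by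
          have := inv_nonneg.2 ht.1.le
          exact mul_le_mul (hw1 x) (by gcongr) (by positivity) zero_le_one
      _ = M := by have := ht.1.ne'; field_simp
  · refine Eventually.of_forall fun x => Tendsto.const_mul _ ?_
    have h := ((hu.differentiable (by simp) x).hasFDerivAt.hasLineDerivAt
      (EuclideanSpace.single i (1 : ℝ))).tendsto_slope_zero_right
    simpa [partialDeriv] using h

lemma integral_partialDeriv_eq_zero (hu : ContDiff ℝ (⊤ : ℕ∞) u) (hp : ZnPeriodic u) (i : Fin n) :
    ∫ x in fund n, partialDeriv i u x = 0 := by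
  have h := tendsto_integral_difference_quotient hu i (w := fun _ => 1) measurable_const (by simp)
  simp only [one_mul] at h
  refine tendsto_nhds_unique h (tendsto_const_nhds.congr fun t => ?_)
  have hc := hu.continuous
  rw [integral_const_mul, integral_sub, hp.setIntegral_fund_add, sub_self, mul_zero]
  · exact Continuous.integrableOn_fund (by fun_prop)
  · exact hc.integrableOn_fund

end PartialDeriv

lemma exists_mem_segment_eq_zero {g : ℝ → ℝ} (hg : Continuous g) {t : ℝ} (ht : 0 ≤ t)
    (h : Real.sign (g t) ≠ Real.sign (g 0)) : ∃ τ ∈ Icc 0 t, g τ = 0 := by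
  rcases lt_trichotomy (g 0) 0 with h0 | h0 | h0
  · rcases le_or_gt 0 (g t) with h1 | h1
    · exact intermediate_value_Icc ht hg.continuousOn ⟨h0.le, h1⟩
    · exact absurd (by rw [Real.sign_of_neg h0, Real.sign_of_neg h1]) h
  · exact ⟨0, ⟨le_rfl, ht⟩, h0⟩
  · rcases le_or_gt (g t) 0 with h1 | h1
    · exact intermediate_value_Icc' ht hg.continuousOn ⟨h1, h0.le⟩
    · exact absurd (by rw [Real.sign_of_pos h0, Real.sign_of_pos h1]) h

lemma measurable_real_sign : Measurable Real.sign := by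
  unfold Real.sign
  exact Measurable.ite measurableSet_Iio measurable_const
    (Measurable.ite measurableSet_Ioi measurable_const measurable_const)

lemma abs_real_sign_le_one (r : ℝ) : |Real.sign r| ≤ 1 := by
  rcases Real.sign_apply_eq r with h | h | h <;> simp [h]

section SignChange

variable {n : ℕ} {φ u : EuclideanSpace ℝ (Fin n) → ℝ}

lemma volume_sign_change_le (hn : 2 ≤ n) (hφ : Continuous φ) (hp : ZnPeriodic φ) (i : Fin n)
    {t : ℝ} (ht : 0 < t) (ht1 : t ≤ 1) :
    volume {x ∈ fund n | Real.sign (φ (x - t • EuclideanSpace.single i (1 : ℝ))) ≠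
        Real.sign (φ x)} ≤
      2 * (ENNReal.ofReal (3 * 2 ^ (n - 1) * t) * μH[(n : ℝ) - 1] {x ∈ fund n | φ x = 0}) := by
  set e : EuclideanSpace ℝ (Fin n) := EuclideanSpace.single i (1 : ℝ) with he
  set Z := {x ∈ fund n | φ x = 0}
  set S := {x : EuclideanSpace ℝ (Fin n) | ∃ τ ∈ Icc 0 t, x - τ • e ∈ Z} with hS
  have hSle := volume_sweep_le hn i ht Z
  have hsub : {x ∈ fund n | Real.sign (φ (x - t • e)) ≠ Real.sign (φ x)} ⊆
      S ∪ (fun x => x + e) ⁻¹' S := by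
    rintro x ⟨hx, hsx⟩
    obtain ⟨τ, hτ, h0⟩ := exists_mem_segment_eq_zero (g := fun τ => φ (x - τ • e)) (by fun_prop)
      ht.le (by simpa using hsx)
    have hj : ∀ j, j ≠ i → (x - τ • e) j = x j := fun j hj => by simp [he, hj]
    have hi : (x - τ • e) i = x i - τ := by simp [he]
    rcases le_or_gt 0 ((x - τ • e) i) with h | h
    · left
      refine ⟨τ, hτ, fun j => ?_, h0⟩
      by_cases hji : j = i
      · subst hji
        exact ⟨h, by rw [hi]; linarith [(hx j).2, hτ.1]⟩
      · rw [hj j hji]; exact hx j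
    · right
      refine ⟨τ, hτ, ?_⟩
      have hcomm : x + e - τ • e = (x - τ • e) + e := by abel
      rw [hcomm]
      refine ⟨fun j => ?_, by rw [hp.add_single]; exact h0⟩
      by_cases hji : j = i
      · subst hji
        have hej : ((x - τ • e) + e) j = (x - τ • e) j + 1 := by simp [he]
        rw [hej]
        exact ⟨by rw [hi]; linarith [(hx j).1, hτ.2], by linarith⟩
      · have hej : ((x - τ • e) + e) j = x j := by simp [he, hji]
        rw [hej]; exact hx j
  calc _ ≤ volume (S ∪ (fun x => x + e) ⁻¹' S) := measure_mono hsub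
    _ ≤ volume S + volume ((fun x => x + e) ⁻¹' S) := measure_union_le _ _
    _ = 2 * volume S := by rw [measure_preimage_add_right, two_mul]
    _ ≤ _ := by gcongr

/-- The sign of a periodic function has total variation controlled by the Hausdorff measure of the
nodal set. -/
lemma abs_integral_sign_mul_partialDeriv_le (hn : 2 ≤ n) (hφ : Continuous φ) (hp : ZnPeriodic φ)
    (hH : μH[(n : ℝ) - 1] {x ∈ fund n | φ x = 0} ≠ ∞) (hu : ContDiff ℝ (⊤ : ℕ∞) u)
    (hup : ZnPeriodic u) {B : ℝ} (hB : ∀ x, |u x| ≤ B) (i : Fin n) :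
    |∫ x in fund n, Real.sign (φ x) * partialDeriv i u x| ≤
      12 * 2 ^ (n - 1) * B * (μH[(n : ℝ) - 1] {x ∈ fund n | φ x = 0}).toReal := by
  set e : EuclideanSpace ℝ (Fin n) := EuclideanSpace.single i (1 : ℝ) with he
  set H := (μH[(n : ℝ) - 1] {x ∈ fund n | φ x = 0}).toReal with hHdef
  have hB0 : 0 ≤ B := (abs_nonneg _).trans (hB 0)
  have hwm : Measurable fun x => Real.sign (φ x) := measurable_real_sign.comp hφ.measurable
  have hlim := tendsto_integral_difference_quotient hu i hwm fun x => abs_real_sign_le_one _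
  refine le_of_tendsto hlim.abs ?_
  filter_upwards [Ioc_mem_nhdsGT (zero_lt_one' ℝ)] with t ht
  have hint : ∀ {s g : EuclideanSpace ℝ (Fin n) → ℝ}, Measurable s → (∀ x, |s x| ≤ 1) →
      Continuous g → IntegrableOn (fun x => s x * g x) (fund n) := fun hs hs1 hg =>
    hg.integrableOn_fund.bdd_mul hs.aestronglyMeasurable (c := 1)
      (Eventually.of_forall fun x => hs1 x)
  have hwm' : Measurable fun x => Real.sign (φ (x - t • e)) :=
    measurable_real_sign.comp (by fun_prop : Continuous fun x => φ (x - t • e)).measurable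
  have huc := hu.continuous
  have hshift : ∫ x in fund n, Real.sign (φ x) * u (x + t • e) =
      ∫ x in fund n, Real.sign (φ (x - t • e)) * u x := by
    have hper : ZnPeriodic fun x => Real.sign (φ (x - t • e)) * u x := fun x k => by
      simp only
      rw [hup, add_sub_right_comm, hp]
    rw [← hper.setIntegral_fund_add (t • e)]
    simp
  have heq : ∫ x in fund n, Real.sign (φ x) * (t⁻¹ * (u (x + t • e) - u x)) =
      t⁻¹ * ∫ x in fund n, (Real.sign (φ (x - t • e)) - Real.sign (φ x)) * u x := by
    simp_rw [sub_mul, mul_left_comm _ t⁻¹]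
    rw [integral_const_mul]
    simp_rw [mul_sub]
    rw [integral_sub, integral_sub, hshift]
    · exact hint hwm' (fun x => abs_real_sign_le_one _) huc
    · exact hint hwm (fun x => abs_real_sign_le_one _) huc
    · exact hint hwm (fun x => abs_real_sign_le_one _) (by fun_prop)
    · exact hint hwm (fun x => abs_real_sign_le_one _) huc
  set A := {x ∈ fund n | Real.sign (φ (x - t • e)) ≠ Real.sign (φ x)} with hA
  have hAm : MeasurableSet A :=
    (measurableSet_fund n).inter (measurableSet_eq_fun hwm' hwm).compl
  have hAv := volume_sign_change_le hn hφ hp i ht.1 ht.2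
  have hAfin : volume A < ∞ := (measure_mono (sep_subset _ _)).trans_lt (volume_fund_lt_top n)
  have hAr : (volume A).toReal ≤ 6 * 2 ^ (n - 1) * t * H := by
    have := ENNReal.toReal_mono (by finiteness) hAv
    rw [ENNReal.toReal_mul, ENNReal.toReal_mul,
      ENNReal.toReal_ofReal (by have := ht.1; positivity)] at this
    refine this.trans (le_of_eq ?_)
    rw [hHdef]
    simp only [ENNReal.toReal_ofNat]
    ring
  have hbound : |∫ x in fund n, (Real.sign (φ (x - t • e)) - Real.sign (φ x)) * u x| ≤
      2 * B * (volume A).toReal := by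
    have hres : ∫ x in fund n, (Real.sign (φ (x - t • e)) - Real.sign (φ x)) * u x =
        ∫ x in A, (Real.sign (φ (x - t • e)) - Real.sign (φ x)) * u x := by
      refine setIntegral_eq_of_subset_of_forall_sdiff_eq_zero (measurableSet_fund n)
        (sep_subset _ _) fun x hx => ?_
      have : Real.sign (φ (x - t • e)) = Real.sign (φ x) := by
        by_contra h
        exact hx.2 ⟨hx.1, h⟩
      simp [this]
    rw [hres, ← Real.norm_eq_abs]
    refine norm_setIntegral_le_of_norm_le_const hAfin fun x _ => ?_
    rw [Real.norm_eq_abs, abs_mul]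
    have h1 := abs_sub (Real.sign (φ (x - t • e))) (Real.sign (φ x))
    have h2 := abs_real_sign_le_one (φ (x - t • e))
    have h3 := abs_real_sign_le_one (φ x)
    exact mul_le_mul (by linarith) (hB x) (abs_nonneg _) (by norm_num)
  rw [heq, abs_mul, abs_inv, abs_of_pos ht.1, inv_mul_le_iff₀ ht.1]
  calc _ ≤ 2 * B * (volume A).toReal := hbound
    _ ≤ 2 * B * (6 * 2 ^ (n - 1) * t * H) := by gcongr
    _ = _ := by ring

end SignChange

section Energy

variable {n : ℕ} {u : EuclideanSpace ℝ (Fin n) → ℝ} {lam : ℝ}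

lemma integral_sq_partialDeriv_le (hu : ContDiff ℝ (⊤ : ℕ∞) u) (hp : ZnPeriodic u)
    (hE : ∀ x, lap u x = -lam ^ 2 * u x) (i : Fin n) :
    ∫ x in fund n, partialDeriv i u x ^ 2 ≤ lam ^ 2 * ∫ x in fund n, u x ^ 2 := by
  have huc := hu.continuous
  have hdc := fun j => (hu.partialDeriv j).continuous
  have hddc := fun j => ((hu.partialDeriv j).partialDeriv j).continuous
  have hz : ∀ j, ∫ x in fund n, partialDeriv j (fun y => u y * partialDeriv j u y) x = 0 :=
    fun j => integral_partialDeriv_eq_zero (hu.mul (hu.partialDeriv j))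
      (fun x k => by simp only [hp x k, hp.partialDeriv j x k]) j
  have hz' : ∀ j, ∫ x in fund n, partialDeriv j u x ^ 2 =
      -∫ x in fund n, u x * partialDeriv j (partialDeriv j u) x := by
    intro j
    have h := hz j
    simp_rw [partialDeriv_mul hu (hu.partialDeriv j), ← pow_two] at h
    rw [integral_add (Continuous.integrableOn_fund (huc.fun_mul (hddc j)))
      (Continuous.integrableOn_fund ((hdc j).fun_pow 2))] at h
    linarith
  calc ∫ x in fund n, partialDeriv i u x ^ 2
      ≤ ∑ j, ∫ x in fund n, partialDeriv j u x ^ 2 :=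
        Finset.single_le_sum (f := fun j => ∫ x in fund n, partialDeriv j u x ^ 2)
          (fun j _ => integral_nonneg fun x => sq_nonneg _) (Finset.mem_univ i)
    _ = -∫ x in fund n, u x * lap u x := by
        simp_rw [hz', Finset.sum_neg_distrib]
        rw [← integral_finsetSum _ fun j _ =>
          Continuous.integrableOn_fund (huc.fun_mul (hddc j))]
        simp_rw [← Finset.mul_sum]
        rfl
    _ = _ := by
        rw [← integral_neg, ← integral_const_mul]
        congr 1
        ext x
        rw [hE]
        ring

lemma lap_partialDeriv (hu : ContDiff ℝ (⊤ : ℕ∞) u) (hE : ∀ x, lap u x = -lam ^ 2 * u x)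
    (i : Fin n) (x : EuclideanSpace ℝ (Fin n)) :
    lap (partialDeriv i u) x = -lam ^ 2 * partialDeriv i u x := by
  have h1 : lap (partialDeriv i u) x = partialDeriv i (lap u) x := by
    have : lap u = fun y => ∑ j, partialDeriv j (partialDeriv j u) y := rfl
    rw [this, partialDeriv_sum _ fun j => (hu.partialDeriv j).partialDeriv j]
    refine Finset.sum_congr rfl fun j _ => ?_
    rw [partialDeriv_comm (hu.partialDeriv j) i j, partialDeriv_comm hu i j]
    rfl
  rw [h1, funext hE]
  exact partialDeriv_comp ((hasDerivAt_id' _).const_mul (-lam ^ 2) |>.congr_deriv (by ring)) hu i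

end Energy

lemma abs_sub_inv_one_add_sq_mul_le {s lam : ℝ} (hs : 0 < s) (hlam : 0 < lam) (p q : ℝ) :
    |q - 1 / (1 + (p / s) ^ 2) * (1 / s) * s * q| ≤ (lam * p ^ 2 + q ^ 2 / lam) / (4 * s) := by
  have h1 : q - 1 / (1 + (p / s) ^ 2) * (1 / s) * s * q =
      (p / s) ^ 2 / (1 + (p / s) ^ 2) * q := by
    have : 1 + (p / s) ^ 2 ≠ 0 := by positivity
    field_simp
    ring
  have h2 : (p / s) ^ 2 / (1 + (p / s) ^ 2) ≤ |p| / (2 * s) := by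
    rw [div_le_iff₀ (by positivity)]
    have : |p| / (2 * s) = |p / s| / 2 := by
      rw [abs_div, abs_of_pos hs]; field_simp
    rw [this, ← sq_abs]
    nlinarith [abs_nonneg (p / s), mul_nonneg (abs_nonneg (p / s)) (sq_nonneg (|p / s| - 1))]
  have h3 : 2 * (|p| * |q|) ≤ lam * p ^ 2 + q ^ 2 / lam := by
    rw [← sub_nonneg, ← sq_abs p, ← sq_abs q]
    have : lam * |p| ^ 2 + |q| ^ 2 / lam - 2 * (|p| * |q|) = (lam * |p| - |q|) ^ 2 / lam := by
      field_simp; ring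
    rw [this]; positivity
  rw [h1, abs_mul, abs_of_nonneg (by positivity)]
  calc _ ≤ |p| / (2 * s) * |q| := by gcongr
    _ = 2 * (|p| * |q|) / (4 * s) := by field_simp; ring
    _ ≤ _ := by gcongr

lemma sq_mul_integral_abs_le {n : ℕ} (hn : 2 ≤ n) {lam s : ℝ} (hlam : 0 < lam) (hs : 0 < s)
    {φ : EuclideanSpace ℝ (Fin n) → ℝ} (hφ : IsTorusEigenfunction lam φ)
    (hnorm : (∫ x in fund n, (φ x) ^ 2) = 1)
    (hH : μH[(n : ℝ) - 1] {x ∈ fund n | φ x = 0} ≠ ∞) :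
    lam ^ 2 * ∫ x in fund n, |φ x| ≤
      n * (24 * 2 ^ (n - 1) * s * (μH[(n : ℝ) - 1] {x ∈ fund n | φ x = 0}).toReal) +
        n * lam ^ 3 / (2 * s) := by
  obtain ⟨hsm, hp, -, hE⟩ := hφ
  set H := (μH[(n : ℝ) - 1] {x ∈ fund n | φ x = 0}).toReal
  set ψ : Fin n → EuclideanSpace ℝ (Fin n) → ℝ := fun i x =>
    s * Real.arctan (partialDeriv i φ x / s) with hψ
  have hψsm : ∀ i, ContDiff ℝ (⊤ : ℕ∞) (ψ i) := fun i =>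
    contDiff_const.mul (Real.contDiff_arctan.comp ((hsm.partialDeriv i).div_const s))
  have hψp : ∀ i, ZnPeriodic (ψ i) := fun i x k => by
    simp only [hψ, hp.partialDeriv i x k]
  have hψB : ∀ i x, |ψ i x| ≤ 2 * s := by
    intro i x
    have h : |Real.arctan (partialDeriv i φ x / s)| ≤ 2 := by
      have h1 := Real.neg_pi_div_two_lt_arctan (partialDeriv i φ x / s)
      have h2 := Real.arctan_lt_pi_div_two (partialDeriv i φ x / s)
      have h3 := Real.pi_le_four
      rw [abs_le]
      constructor <;> linarith
    rw [hψ, abs_mul, abs_of_pos hs]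
    nlinarith
  have hψd : ∀ i x, partialDeriv i (ψ i) x =
      1 / (1 + (partialDeriv i φ x / s) ^ 2) * (1 / s) * s *
        partialDeriv i (partialDeriv i φ) x := by
    intro i x
    have h := (((hasDerivAt_id' (partialDeriv i φ x)).div_const s).arctan).const_mul s
    exact partialDeriv_comp (h.congr_deriv (by ring)) (hsm.partialDeriv i) i
  have hsgn : Measurable fun x => Real.sign (φ x) :=
    measurable_real_sign.comp hsm.continuous.measurable
  have hint : ∀ {g : EuclideanSpace ℝ (Fin n) → ℝ}, Continuous g →
      IntegrableOn (fun x => Real.sign (φ x) * g x) (fund n) := fun hg =>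
    hg.integrableOn_fund.bdd_mul hsgn.aestronglyMeasurable (c := 1)
      (Eventually.of_forall fun x => abs_real_sign_le_one _)
  have hdc := fun i => (hsm.partialDeriv i).continuous
  have hddc := fun i => ((hsm.partialDeriv i).partialDeriv i).continuous
  have hψc := fun i => ((hψsm i).partialDeriv i).continuous
  have hTV : ∀ i, |∫ x in fund n, Real.sign (φ x) * partialDeriv i (ψ i) x| ≤
      24 * 2 ^ (n - 1) * s * H := fun i =>
    (abs_integral_sign_mul_partialDeriv_le hn hsm.continuous hp hH (hψsm i) (hψp i) (hψB i) i).trans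
      (le_of_eq (by ring))
  have h1 : ∀ i, ∫ x in fund n, partialDeriv i φ x ^ 2 ≤ lam ^ 2 := fun i => by
    simpa [hnorm] using integral_sq_partialDeriv_le hsm hp hE i
  have h2 : ∀ i, ∫ x in fund n, partialDeriv i (partialDeriv i φ) x ^ 2 ≤ lam ^ 4 := fun i => by
    have := integral_sq_partialDeriv_le (hsm.partialDeriv i) (hp.partialDeriv i)
      (lap_partialDeriv hsm hE i) i
    nlinarith [h1 i, sq_nonneg lam]
  have herr : ∀ i, |∫ x in fund n, Real.sign (φ x) *
      (partialDeriv i (partialDeriv i φ) x - partialDeriv i (ψ i) x)| ≤ lam ^ 3 / (2 * s) := by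
    intro i
    have hc : Continuous fun x => (lam * partialDeriv i φ x ^ 2 +
        partialDeriv i (partialDeriv i φ) x ^ 2 / lam) / (4 * s) :=
      by
      have := hdc i
      have := hddc i
      fun_prop
    calc _ ≤ ∫ x in fund n, (lam * partialDeriv i φ x ^ 2 +
            partialDeriv i (partialDeriv i φ) x ^ 2 / lam) / (4 * s) := by
          rw [← Real.norm_eq_abs]
          refine norm_integral_le_of_norm_le hc.integrableOn_fund (Eventually.of_forall fun x => ?_)
          rw [Real.norm_eq_abs, abs_mul, hψd]
          have ha := abs_sub_inv_one_add_sq_mul_le hs hlam (partialDeriv i φ x)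
            (partialDeriv i (partialDeriv i φ) x)
          have hb := abs_real_sign_le_one (φ x)
          exact (mul_le_of_le_one_left (abs_nonneg _) hb).trans ha
      _ = (lam * (∫ x in fund n, partialDeriv i φ x ^ 2) +
            (∫ x in fund n, partialDeriv i (partialDeriv i φ) x ^ 2) / lam) / (4 * s) := by
          rw [integral_div, integral_add, integral_const_mul, integral_div]
          · exact Continuous.integrableOn_fund (continuous_const.fun_mul ((hdc i).fun_pow 2))
          · exact Continuous.integrableOn_fund (((hddc i).fun_pow 2).div_const lam)
      _ ≤ (lam * lam ^ 2 + lam ^ 4 / lam) / (4 * s) := by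
          gcongr
          · exact h1 i
          · exact h2 i
      _ = _ := by field_simp; ring
  have hmain : lam ^ 2 * ∫ x in fund n, |φ x| =
      ∑ i, -((∫ x in fund n, Real.sign (φ x) * partialDeriv i (ψ i) x) +
        ∫ x in fund n, Real.sign (φ x) *
          (partialDeriv i (partialDeriv i φ) x - partialDeriv i (ψ i) x)) := by
    have hsum : ∀ i, -((∫ x in fund n, Real.sign (φ x) * partialDeriv i (ψ i) x) +
        ∫ x in fund n, Real.sign (φ x) *
          (partialDeriv i (partialDeriv i φ) x - partialDeriv i (ψ i) x)) =
        -∫ x in fund n, Real.sign (φ x) * partialDeriv i (partialDeriv i φ) x := by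
      intro i
      rw [← integral_add (hint (hψc i)) (hint ((hddc i).fun_sub (hψc i)))]
      simp_rw [mul_sub, add_sub_cancel]
    simp_rw [hsum, Finset.sum_neg_distrib]
    rw [← integral_finsetSum _ fun i _ => hint (hddc i), ← integral_neg, ← integral_const_mul]
    congr 1
    ext x
    have hx : ∑ i, partialDeriv i (partialDeriv i φ) x = -lam ^ 2 * φ x := hE x
    rw [← Finset.mul_sum, hx]
    rcases lt_trichotomy (φ x) 0 with h | h | h
    · rw [Real.sign_of_neg h, abs_of_neg h]; ring
    · simp [h]
    · rw [Real.sign_of_pos h, abs_of_pos h]; ring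
  rw [hmain]
  calc _ ≤ ∑ _i : Fin n, (24 * 2 ^ (n - 1) * s * H + lam ^ 3 / (2 * s)) := by
        refine Finset.sum_le_sum fun i _ => ?_
        have := (abs_le.1 (hTV i)).1
        have := (abs_le.1 (herr i)).1
        linarith
    _ = _ := by
        rw [Finset.sum_const, Finset.card_univ, Fintype.card_fin, nsmul_eq_mul]
        ring

/-- **The Colding–Minicozzi / Sogge–Zelditch–Hezari lower bound for nodal
volumes, on the flat torus.** There is C = C(n) > 0 such that every
L²-normalized torus eigenfunction with frequency λ ≥ 1 satisfies
λ (∫ |φ| dx)² ≤ C · H^{n-1}(Z_φ). -/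
theorem torus_nodal_volume_lower_bound {n : ℕ} (hn : 2 ≤ n) :
    ∃ C > (0 : ℝ), ∀ lam : ℝ, 1 ≤ lam →
      ∀ φ : EuclideanSpace ℝ (Fin n) → ℝ, IsTorusEigenfunction lam φ →
        (∫ x in fund n, (φ x) ^ 2) = 1 →
        ENNReal.ofReal (lam * (∫ x in fund n, |φ x|) ^ 2)
          ≤ ENNReal.ofReal C * μH[(n:ℝ)-1] {x ∈ fund n | φ x = 0} := by
  have hn0 : (0 : ℝ) < n := by positivity
  refine ⟨48 * n ^ 2 * 2 ^ (n - 1), by positivity, fun lam hlam φ hφ hnorm => ?_⟩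
  have hlam0 : 0 < lam := by linarith
  by_cases hH : μH[(n : ℝ) - 1] {x ∈ fund n | φ x = 0} = ∞
  · rw [hH, ENNReal.mul_top (ENNReal.ofReal_pos.2 (by positivity)).ne']
    exact le_top
  rw [← ENNReal.ofReal_toReal hH, ← ENNReal.ofReal_mul (by positivity)]
  apply ENNReal.ofReal_le_ofReal
  set H := (μH[(n : ℝ) - 1] {x ∈ fund n | φ x = 0}).toReal with hHdef
  have hH0 : 0 ≤ H := ENNReal.toReal_nonneg
  set a := ∫ x in fund n, |φ x| with ha
  have ha0 : 0 ≤ a := integral_nonneg fun x => abs_nonneg _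
  rcases ha0.eq_or_lt with ha0 | ha0
  · rw [← ha0]
    simp only [ne_eq, OfNat.ofNat_ne_zero, not_false_eq_true, zero_pow, mul_zero]
    positivity
  have key := sq_mul_integral_abs_le hn hlam0 (s := n * lam / a) (by positivity) hφ hnorm hH
  rw [← ha, ← hHdef] at key
  have h1 : n * lam ^ 3 / (2 * (n * lam / a)) = lam ^ 2 * a / 2 := by field_simp
  rw [h1] at key
  have h2 : lam ^ 2 * a / 2 ≤ n * (24 * 2 ^ (n - 1) * (n * lam / a) * H) := by linarith
  have h3 := mul_le_mul_of_nonneg_left h2 (by positivity : 0 ≤ 2 * a / lam)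
  have h4 : 2 * a / lam * (lam ^ 2 * a / 2) = lam * a ^ 2 := by field_simp
  have h5 : 2 * a / lam * (n * (24 * 2 ^ (n - 1) * (n * lam / a) * H)) =
      48 * n ^ 2 * 2 ^ (n - 1) * H := by field_simp; ring
  rw [h4, h5] at h3
  exact h3
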